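/- Let H be a real Hilbert space, let a : H × H → ℝ be a bilinear form that is symmetric (a(u,v) = a(v,u) for all u, v), bounded (there exists M ≥ 0 with |a(u,v)| ≤ M‖u‖‖v‖ for all u, v), and coercive (there exists α > 0 with a(v,v) ≥ α‖v‖² for all v), let f : H → ℝ be a continuous linear functional, and let V ⊆ H be a nonempty closed convex set. Define J(v) = (1/2)a(v,v) − f(v). Then an element u ∈ V satisfies the variational inequality a(u, v − u) ≥ f(v − u) for all v ∈ V if and only if u minimizes J over V, i.e. J(u) ≤ J(v) for all v ∈ V. -/

import Mathlib

/-- Second-order expansion of the quadratic energy of a symmetric bilinear form along a line. -/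
theorem ritzEnergy_add_smul {E : Type*} [AddCommGroup E] [Module ℝ E]
    (a : E →ₗ[ℝ] E →ₗ[ℝ] ℝ) (hsymm : ∀ u v : E, a u v = a v u) (f : E →ₗ[ℝ] ℝ)
    (u w : E) (t : ℝ) :
    (1 / 2) * a (u + t • w) (u + t • w) - f (u + t • w) =
      ((1 / 2) * a u u - f u) + t * (a u w - f w) + t ^ 2 / 2 * a w w := by
  simp only [map_add, map_smul, LinearMap.add_apply, LinearMap.smul_apply, smul_eq_mul]
  rw [hsymm w u]
  ring

/-- If `d * t + q / 2 * t ^ 2` is nonnegative on `[0, 1]` and `0 ≤ q`, then its slope `d` at `0`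
is nonnegative. -/
theorem nonneg_of_forall_quadratic_nonneg {d q : ℝ} (hq : 0 ≤ q)
    (h : ∀ t : ℝ, 0 ≤ t → t ≤ 1 → 0 ≤ t * d + t ^ 2 / 2 * q) : 0 ≤ d := by
  by_contra! hd
  have hpos : 0 < q - d := by linarith
  set t := -d / (q - d) with ht
  have ht0 : 0 < t := div_pos (by linarith) hpos
  have ht1 : t ≤ 1 := (div_le_one hpos).2 (by linarith)
  have hmul : t * (q - d) = -d := div_mul_cancel₀ _ hpos.ne'
  have hfactor : 0 ≤ t * (d + t / 2 * q) := (h t ht0.le ht1).trans_eq (by ring)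
  have hslope := nonneg_of_mul_nonneg_right hfactor ht0
  have htd : t * d < 0 := mul_neg_of_pos_of_neg ht0 hd
  linarith

/-- Equivalence of the elliptic variational inequality `a(u, v - u) ≥ f(v - u)` for all
`v ∈ V` with the minimization of the Ritz energy functional `J(v) = (1/2) a(v,v) - f(v)`
over the nonempty closed convex set `V`, for a symmetric, bounded, coercive bilinear
form `a` and a continuous linear functional `f` on a real Hilbert space `H`. -/
theorem variational_inequality_iff_min
    {H : Type*} [NormedAddCommGroup H] [InnerProductSpace ℝ H] [CompleteSpace H]
    (a : H →ₗ[ℝ] H →ₗ[ℝ] ℝ)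
    (hsymm : ∀ u v : H, a u v = a v u)
    (hbdd : ∃ M : ℝ, 0 ≤ M ∧ ∀ u v : H, |a u v| ≤ M * ‖u‖ * ‖v‖)
    (hcoer : ∃ α : ℝ, 0 < α ∧ ∀ v : H, a v v ≥ α * ‖v‖ ^ 2)
    (f : H →L[ℝ] ℝ)
    (V : Set H) (hVne : V.Nonempty) (hVclosed : IsClosed V) (hVconv : Convex ℝ V)
    (J : H → ℝ) (hJ : ∀ v : H, J v = (1 / 2) * a v v - f v)
    (u : H) (hu : u ∈ V) :
    (∀ v ∈ V, a u (v - u) ≥ f (v - u)) ↔ (∀ v ∈ V, J u ≤ J v) := by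
  obtain ⟨α, hα, hcoer⟩ := hcoer
  have hnonneg (w : H) : 0 ≤ a w w := le_trans (by positivity) (hcoer w)
  have hexpand (v : H) (t : ℝ) : J (u + t • (v - u)) =
      J u + t * (a u (v - u) - f (v - u)) + t ^ 2 / 2 * a (v - u) (v - u) := by
    rw [hJ, hJ]
    exact ritzEnergy_add_smul a hsymm f u (v - u) t
  constructor
  · intro h v hv
    have hJv := hexpand v 1
    rw [one_smul, add_sub_cancel] at hJv
    linarith [h v hv, hnonneg (v - u)]
  · intro h v hv
    refine sub_nonneg.1 (nonneg_of_forall_quadratic_nonneg (hnonneg (v - u)) fun t ht0 ht1 => ?_)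
    have hmin := h _ (hVconv.add_smul_sub_mem hu hv ⟨ht0, ht1⟩)
    rw [hexpand] at hmin
    linarith
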